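/- arXiv:2510.10554 — 2 statements merged into one kernel-verified Lean document; each statement's English description precedes it below -/
import Mathlib

section
/- Let k ≥ 2 be an integer, α, β ∈ ℝ∖ℤ, and x ∈ ℂ with Re(x) > 0. Then 𝓕_k(x; α, β) + 𝓕_k(x; −α, −β) − 𝓕_k(x+1; α+β, β) − 𝓕_k(x+1; −α−β, −β) + (−x)^{k−2}·𝓕_k((x+1)/x; α+β, α) + (−x)^{k−2}·𝓕_k((x+1)/x; −α−β, −α) = (1/x)·[Li_k(e^{2πiα}) + Li_k(e^{−2πiα})] − ((−x)^{k−1}/(x+1))·[Li_k(e^{2πi(α+β)}) + Li_k(e^{−2πi(α+β)})] + Σ_{r=1}^{k−1} (−x)^{r−1}·[Li_{r,k−r}(e^{2πiβ}, e^{2πiα}) + Li_{r,k−r}(e^{−2πiβ}, e^{−2πiα})]. -/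
open Complex MeasureTheory Filter Topology Set Asymptotics

noncomputable section

/-- `e2pi θ = e^{2πiθ}`. -/
def e2pi (θ : ℝ) : ℂ := Complex.exp (2 * Real.pi * Complex.I * θ)

/-- Polylogarithm of integer order: `Li 0 z = z/(1-z)`, `Li 1 z = -Log(1-z)`,
`Li m z = ∑_{n≥1} z^n/n^m` for `m ≥ 2`. -/
def Li : ℕ → ℂ → ℂ
  | 0, z => z / (1 - z)
  | 1, z => -Complex.log (1 - z)
  | (m+2), z => ∑' n : ℕ, z ^ (n+1) / ((n+1 : ℕ) : ℂ) ^ (m+2)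

/-- The double polylogarithm `Li_{a,b}(z₁,z₂) = ∑_{0<p<q} z₁^p z₂^q/(p^a q^b)`, as an iterated
sum whose inner series is summed as the limit of its partial sums. -/
def Li2 (a b : ℕ) (z₁ z₂ : ℂ) : ℂ :=
  ∑' p : ℕ, (z₁ ^ (p + 1) / ((p + 1 : ℕ) : ℂ) ^ a) *
    limUnder atTop (fun N : ℕ => ∑ q ∈ Finset.Icc (p + 2) N, z₂ ^ q / ((q : ℕ) : ℂ) ^ b)

/-- The higher Herglotz–Zagier–Novikov function
`𝓕_k(x; α, β) = ∫₀^∞ Li_{k-1}(e^{-xt} e^{2πiα}) / (1 - e^{-t} e^{2πiβ}) dt`. -/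
def HHZN (k : ℕ) (x : ℂ) (α β : ℝ) : ℂ :=
  ∫ t in Set.Ioi (0:ℝ),
    Li (k-1) (Complex.exp (-x * t) * e2pi α) / (1 - Complex.exp (-(t:ℂ)) * e2pi β)

def EE (w b : ℂ) : ℂ := ∫ t in Set.Ioi (0:ℝ), Complex.exp (-w * t) / (1 - Complex.exp (-(t:ℂ)) * b)

lemma lower_bd (b : ℂ) (hb : ‖b‖ = 1) (hb1 : b ≠ 1) :
    ∃ c : ℝ, 0 < c ∧ ∀ t : ℝ, 0 < t → c ≤ ‖1 - Complex.exp (-(t:ℂ)) * b‖ := by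
  have hc : ContinuousOn (fun s : ℝ => ‖1 - (s:ℂ) * b‖) (Set.Icc 0 1) := by fun_prop
  obtain ⟨s, hs, hmin⟩ := isCompact_Icc.exists_isMinOn (Set.nonempty_Icc.2 zero_le_one) hc
  refine ⟨‖1 - (s:ℂ) * b‖, ?_, fun t ht => ?_⟩
  · rw [norm_pos_iff]
    intro h
    have h1 : (s:ℂ) * b = 1 := (sub_eq_zero.1 h).symm
    have h2 : s = 1 := by
      have := congrArg norm h1
      rw [norm_mul, hb, Complex.norm_real, Real.norm_of_nonneg hs.1] at this
      simpa using this
    rw [h2] at h1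
    exact hb1 (by simpa using h1)
  · have := hmin (show Real.exp (-t) ∈ Set.Icc (0:ℝ) 1 from
      ⟨(Real.exp_pos _).le, Real.exp_le_one_iff.2 (by linarith)⟩)
    simpa using this

lemma EE_facts (b : ℂ) (hb : ‖b‖ = 1) (hb1 : b ≠ 1) :
    ∃ C : ℝ, 0 < C ∧ ∀ w : ℂ, 0 < w.re →
      IntegrableOn (fun t : ℝ => Complex.exp (-w * t) / (1 - Complex.exp (-(t:ℂ)) * b)) (Ioi 0) ∧
      (∫ t in Set.Ioi (0:ℝ), ‖Complex.exp (-w * t) / (1 - Complex.exp (-(t:ℂ)) * b)‖)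
        ≤ C / w.re ∧ ‖EE w b‖ ≤ C / w.re := by
  obtain ⟨c, hc, hl⟩ := lower_bd b hb hb1
  refine ⟨c⁻¹, by positivity, fun w hw => ?_⟩
  have hbd : ∀ t : ℝ, t ∈ Ioi (0:ℝ) →
      ‖Complex.exp (-w * t) / (1 - Complex.exp (-(t:ℂ)) * b)‖ ≤ c⁻¹ * Real.exp (-w.re * t) := by
    intro t ht
    rw [norm_div, Complex.norm_exp, div_eq_inv_mul]
    have h2 : (-w * (t:ℂ)).re = -w.re * t := by simp
    rw [h2]
    gcongr
    exact hl t ht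
  have hi : IntegrableOn (fun t : ℝ => c⁻¹ * Real.exp (-w.re * t)) (Ioi 0) :=
    (integrableOn_exp_mul_Ioi (by linarith) 0).const_mul _
  have hint : IntegrableOn
      (fun t : ℝ => Complex.exp (-w * t) / (1 - Complex.exp (-(t:ℂ)) * b)) (Ioi 0) := by
    refine Integrable.mono' hi ?_ ?_
    · exact Measurable.aestronglyMeasurable (by fun_prop)
    · exact (ae_restrict_iff' measurableSet_Ioi).2 (Eventually.of_forall hbd)
  have hle : (∫ t in Set.Ioi (0:ℝ), ‖Complex.exp (-w * t) / (1 - Complex.exp (-(t:ℂ)) * b)‖)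
        ≤ c⁻¹ / w.re := by
    refine (setIntegral_mono_on hint.norm hi measurableSet_Ioi hbd).trans ?_
    rw [integral_const_mul, integral_exp_mul_Ioi (by linarith)]
    simp [div_eq_mul_inv]
  exact ⟨hint, hle, (norm_integral_le_integral_norm _).trans hle⟩

lemma EE_succ (b : ℂ) (hb : ‖b‖ = 1) (hb1 : b ≠ 1) (w : ℂ) (hw : 0 < w.re) :
    EE w b = 1 / w + b * EE (w + 1) b := by
  obtain ⟨C, hC, hE⟩ := EE_facts b hb hb1
  obtain ⟨c, hc, hl⟩ := lower_bd b hb hb1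
  have h1 := (hE w hw).1
  have h2 := (hE (w+1) (by simp; linarith)).1
  have key : EE w b - b * EE (w+1) b = ∫ t in Set.Ioi (0:ℝ), Complex.exp (-w * t) := by
    unfold EE
    rw [← integral_const_mul, ← integral_sub h1 (h2.const_mul b)]
    refine setIntegral_congr_fun measurableSet_Ioi fun t ht => ?_
    have hne : 1 - Complex.exp (-(t:ℂ)) * b ≠ 0 := by
      rw [← norm_pos_iff]; exact hc.trans_le (hl t ht)
    have he : Complex.exp (-(w+1) * t) = Complex.exp (-w * t) * Complex.exp (-(t:ℂ)) := by
      rw [← Complex.exp_add]; congr 1; ring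
    simp only [he]
    field_simp
  rw [integral_exp_mul_complex_Ioi (by simpa using hw)] at key
  rw [← sub_eq_iff_eq_add, key]
  simp [neg_div_neg_eq]

lemma EE_sum (b : ℂ) (hb : ‖b‖ = 1) (hb1 : b ≠ 1) (w : ℂ) (hw : 0 < w.re) (n : ℕ) :
    ∑ j ∈ Finset.range n, b ^ j / (w + j) = EE w b - b ^ n * EE (w + n) b := by
  induction n with
  | zero => simp
  | succ n ih =>
    rw [Finset.sum_range_succ, ih, EE_succ b hb hb1 (w + n) (by simp; positivity)]
    push_cast
    rw [add_assoc w]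
    ring

lemma Li_hasSum (m : ℕ) (hm : 1 ≤ m) (z : ℂ) (hz : ‖z‖ < 1) :
    HasSum (fun n : ℕ => z ^ (n+1) / ((n:ℂ)+1) ^ m) (Li m z) := by
  rcases m with _ | _ | m
  · omega
  · have h := Complex.hasSum_taylorSeries_neg_log hz
    rw [← hasSum_nat_add_iff' 1] at h
    simpa [Li] using h
  · have : Summable (fun n : ℕ => z ^ (n+1) / ((n:ℂ)+1) ^ (m+2)) := by
      have h1 : Summable (fun n : ℕ => ‖z‖ ^ (n+1)) :=
        (summable_nat_add_iff 1).2 (summable_geometric_of_lt_one (norm_nonneg _) hz)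
      refine Summable.of_norm_bounded h1 fun n => ?_
      rw [norm_div, norm_pow, norm_pow]
      have : (1:ℝ) ≤ ‖((n:ℂ)+1)‖ := by
        have : ((n:ℂ)+1) = ((n+1:ℕ):ℂ) := by push_cast; rfl
        rw [this, Complex.norm_natCast]; push_cast; linarith [n.cast_nonneg (α := ℝ)]
      exact div_le_self (by positivity) (one_le_pow₀ this)
    have h := this.hasSum
    simpa [Li] using h

lemma norm_succ (n : ℕ) : ‖((n:ℂ)+1)‖ = (n:ℝ)+1 := by
  have : ((n:ℂ)+1) = ((n+1:ℕ):ℂ) := by push_cast; rfl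
  rw [this, Complex.norm_natCast]; push_cast; rfl

lemma summable_sq : Summable (fun n : ℕ => 1 / ((n:ℝ)+1)^2) := by
  have := (summable_nat_add_iff 1).2 (Real.summable_one_div_nat_pow.2 (le_refl 2))
  simpa using this

lemma Li_hasSum_one (k : ℕ) (hk : 2 ≤ k) (z : ℂ) (hz : ‖z‖ = 1) :
    HasSum (fun n : ℕ => z ^ (n+1) / ((n:ℂ)+1) ^ k) (Li k z) := by
  obtain ⟨m, rfl⟩ := Nat.exists_eq_add_of_le' hk
  have : Summable (fun n : ℕ => z ^ (n+1) / ((n:ℂ)+1) ^ (m+2)) := by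
    refine Summable.of_norm_bounded summable_sq fun n => ?_
    rw [norm_div, norm_pow, norm_pow, norm_succ, hz, one_pow]
    gcongr
    linarith [n.cast_nonneg (α := ℝ)]
  have h := this.hasSum
  simpa [Li] using h

lemma e2pi_norm (θ : ℝ) : ‖e2pi θ‖ = 1 := by
  unfold e2pi
  rw [Complex.norm_exp]; simp

lemma e2pi_add (θ η : ℝ) : e2pi (θ + η) = e2pi θ * e2pi η := by
  unfold e2pi
  rw [← Complex.exp_add]; congr 1; push_cast; ring

lemma e2pi_ne_one (θ : ℝ) (h : ∀ n : ℤ, θ ≠ n) : e2pi θ ≠ 1 := by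
  unfold e2pi
  intro h1
  obtain ⟨n, hn⟩ := Complex.exp_eq_one_iff.1 h1
  have h2 : (2 * Real.pi * Complex.I : ℂ) ≠ 0 := Complex.two_pi_I_ne_zero
  have h3 : (θ:ℂ) = n := by
    apply mul_left_cancel₀ h2; rw [hn]; ring
  exact h n (by exact_mod_cast h3)

lemma HHZN_hasSum (k : ℕ) (hk : 2 ≤ k) (y : ℂ) (hy : 0 < y.re) (α β : ℝ) (hβ : e2pi β ≠ 1) :
    HasSum (fun n : ℕ => e2pi α ^ (n+1) / ((n:ℂ)+1) ^ (k-1) * EE (y * (n+1)) (e2pi β))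
      (HHZN k y α β) := by
  obtain ⟨C, hC, hE⟩ := EE_facts (e2pi β) (e2pi_norm β) hβ
  have hre : ∀ n : ℕ, (y * (n+1)).re = y.re * (n+1) := by intro n; simp
  have hre' : ∀ n : ℕ, 0 < (y * (n+1)).re := by intro n; rw [hre]; positivity
  let F : ℕ → ℝ → ℂ := fun n t => e2pi α ^ (n+1) / ((n:ℂ)+1) ^ (k-1) *
    (Complex.exp (-(y * (n+1)) * t) / (1 - Complex.exp (-(t:ℂ)) * e2pi β))
  have hF1 : ∀ n, Integrable (F n) (volume.restrict (Ioi 0)) := fun n =>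
    (hE _ (hre' n)).1.const_mul _
  have hF2 : Summable fun n => ∫ t in Ioi (0:ℝ), ‖F n t‖ := by
    refine Summable.of_nonneg_of_le (fun n => integral_nonneg fun t => norm_nonneg _) (fun n => ?_)
      (summable_sq.mul_left (C / y.re))
    simp only [F, norm_mul]
    rw [integral_const_mul]
    have h1 := (hE _ (hre' n)).2.1
    rw [hre] at h1
    have h2 : ‖e2pi α ^ (n+1) / ((n:ℂ)+1) ^ (k-1)‖ ≤ 1 / ((n:ℝ)+1) := by
      rw [norm_div, norm_pow, norm_pow, norm_succ, e2pi_norm, one_pow]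
      gcongr
      exact le_self_pow₀ (by linarith [n.cast_nonneg (α := ℝ)]) (by omega)
    calc _ ≤ 1 / ((n:ℝ)+1) * (C / (y.re * (n+1))) := by
            apply mul_le_mul h2 h1 (integral_nonneg fun t => norm_nonneg _) (by positivity)
      _ = _ := by field_simp
  have h := hasSum_integral_of_summable_integral_norm hF1 hF2
  have e1 : ∀ n : ℕ, ∫ t in Ioi (0:ℝ), F n t
      = e2pi α ^ (n+1) / ((n:ℂ)+1) ^ (k-1) * EE (y * (n+1)) (e2pi β) := by
    intro n
    simp only [F, EE]
    rw [integral_const_mul]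
  simp only [e1] at h
  have e2 : HHZN k y α β = ∫ t in Ioi (0:ℝ), ∑' n, F n t := by
    unfold HHZN
    refine setIntegral_congr_fun measurableSet_Ioi fun t ht => ?_
    have hz : ‖Complex.exp (-y * t) * e2pi α‖ < 1 := by
      rw [norm_mul, e2pi_norm, Complex.norm_exp, mul_one, Real.exp_lt_one_iff]
      simp; exact mul_pos hy ht
    have h3 := (Li_hasSum (k-1) (by omega) _ hz).div_const (1 - Complex.exp (-(t:ℂ)) * e2pi β)
    rw [← h3.tsum_eq]
    congr 1
    ext n
    simp only [F]
    have : Complex.exp (-(y * (n+1)) * t) = Complex.exp (-y * t) ^ (n+1) := by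
      rw [← Complex.exp_nat_mul]; congr 1; push_cast; ring
    rw [this, mul_pow]
    ring
  rw [e2]
  exact h

lemma tendsto_Icc (h : ℕ → ℂ) (q : ℕ) (L : ℂ)
    (hL : Tendsto (fun N => ∑ j ∈ Finset.range N, h (q + 2 + j)) atTop (𝓝 L)) :
    Tendsto (fun P => ∑ p ∈ Finset.Icc (q+2) P, h p) atTop (𝓝 L) := by
  have e : ∀ P, ∑ p ∈ Finset.Icc (q+2) P, h p
      = ∑ j ∈ Finset.range (P + 1 - (q+2)), h (q + 2 + j) := by
    intro P
    rw [← Finset.sum_Ico_eq_sum_range]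
    rfl
  simp only [e]
  refine hL.comp (f := fun P => P + 1 - (q+2)) ?_
  refine tendsto_atTop_atTop.2 fun b => ⟨b + q + 2, fun a ha => by omega⟩

lemma bound_Icc (h : ℕ → ℂ) (q : ℕ) (B : ℝ)
    (hL : ∀ N, ‖∑ j ∈ Finset.range N, h (q + 2 + j)‖ ≤ B) (P : ℕ) :
    ‖∑ p ∈ Finset.Icc (q+2) P, h p‖ ≤ B := by
  have e : ∑ p ∈ Finset.Icc (q+2) P, h p
      = ∑ j ∈ Finset.range (P + 1 - (q+2)), h (q + 2 + j) := by
    rw [← Finset.sum_Ico_eq_sum_range]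
    rfl
  rw [e]; exact hL _

lemma abel_bound (a : ℂ) (ha : ‖a‖ = 1) (g : ℕ → ℝ) (hg : Antitone g) (hg0 : ∀ n, 0 ≤ g n)
    (n : ℕ) : ‖(1 - a) * ∑ j ∈ Finset.range n, a ^ j * (g j : ℂ)‖ ≤ 2 * g 0 := by
  have key : ‖(1 - a) * ∑ j ∈ Finset.range n, a ^ j * (g j : ℂ) + a ^ n * (g n : ℂ)‖
      ≤ 2 * g 0 - g n := by
    induction n with
    | zero => simp [abs_of_nonneg (hg0 0)]; linarith
    | succ n ih =>
      have e : (1 - a) * ∑ j ∈ Finset.range (n+1), a ^ j * (g j : ℂ) + a ^ (n+1) * (g (n+1) : ℂ)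
        = ((1 - a) * ∑ j ∈ Finset.range n, a ^ j * (g j : ℂ) + a ^ n * (g n : ℂ))
          + a ^ (n+1) * ((g (n+1) - g n : ℝ) : ℂ) := by
        rw [Finset.sum_range_succ]; push_cast; ring
      rw [e]
      refine (norm_add_le _ _).trans ?_
      have : ‖a ^ (n+1) * ((g (n+1) - g n : ℝ) : ℂ)‖ = g n - g (n+1) := by
        rw [norm_mul, norm_pow, ha, one_pow, one_mul, Complex.norm_real, Real.norm_eq_abs,
          abs_sub_comm, abs_of_nonneg (sub_nonneg.2 (hg n.le_succ))]
      rw [this]; linarith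
  have h2 : ‖a ^ n * (g n : ℂ)‖ = g n := by
    rw [norm_mul, norm_pow, ha, one_pow, one_mul, Complex.norm_real, Real.norm_of_nonneg (hg0 n)]
  have := norm_sub_le ((1 - a) * ∑ j ∈ Finset.range n, a ^ j * (g j : ℂ) + a ^ n * (g n : ℂ))
    (a ^ n * (g n : ℂ))
  rw [add_sub_cancel_right, h2] at this
  linarith

lemma abel_tendsto (a : ℂ) (ha : ‖a‖ = 1) (ha1 : a ≠ 1) (g : ℕ → ℝ) (hg : Antitone g)
    (hlim : Tendsto g atTop (𝓝 0)) :
    ∃ L, Tendsto (fun n => ∑ j ∈ Finset.range n, a ^ j * (g j : ℂ)) atTop (𝓝 L) := by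
  have h1 : 0 < ‖1 - a‖ := norm_pos_iff.2 (sub_ne_zero.2 (Ne.symm ha1))
  have hb : ∀ n, ‖∑ i ∈ Finset.range n, a ^ i‖ ≤ 2 / ‖1 - a‖ := by
    intro n
    have := abel_bound a ha (fun _ => 1) antitone_const (by simp) n
    rw [norm_mul] at this
    rw [le_div_iff₀' h1]
    simpa using this
  have := hg.cauchySeq_series_mul_of_tendsto_zero_of_bounded hlim hb
  obtain ⟨L, hL⟩ := cauchySeq_tendsto_of_complete this
  refine ⟨L, ?_⟩
  convert hL using 4 with n j
  simp [mul_comm]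

lemma T_tendsto (a : ℂ) (ha : ‖a‖ = 1) (ha1 : a ≠ 1) (m : ℕ) (hm : 1 ≤ m) (q : ℕ) :
    ∃ L, Tendsto (fun P => ∑ p ∈ Finset.Icc (q+2) P, a ^ p / (p:ℂ) ^ m) atTop (𝓝 L) := by
  obtain ⟨L, hL⟩ := abel_tendsto a ha ha1 (fun j => 1 / ((q + 2 + j : ℕ):ℝ) ^ m)
    (by
      intro i j hij
      dsimp only
      gcongr)
    (by
      have h1 : Tendsto (fun n : ℕ => 1 / (n:ℝ) ^ m) atTop (𝓝 0) := by
        simp only [one_div]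
        exact tendsto_inv_atTop_zero.comp ((tendsto_pow_atTop (α := ℝ) (by omega)).comp
          tendsto_natCast_atTop_atTop)
      exact h1.comp (tendsto_atTop_mono (fun n => Nat.le_add_left n (q+2)) tendsto_id))
  refine ⟨a ^ (q+2) * L, tendsto_Icc (fun p => a ^ p / (p:ℂ) ^ m) q _ ?_⟩
  convert hL.const_mul (a ^ (q+2)) using 2 with N
  rw [Finset.mul_sum]
  refine Finset.sum_congr rfl fun j _ => ?_
  rw [pow_add]
  push_cast
  ring

lemma T_bound (a : ℂ) (ha : ‖a‖ = 1) (ha1 : a ≠ 1) (m : ℕ) (hm : 1 ≤ m) (q P : ℕ) :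
    ‖∑ p ∈ Finset.Icc (q+2) P, a ^ p / (p:ℂ) ^ m‖ ≤ (2 / ‖1 - a‖) / ((q:ℝ)+1) := by
  have h1 : 0 < ‖1 - a‖ := norm_pos_iff.2 (sub_ne_zero.2 (Ne.symm ha1))
  refine bound_Icc (fun p => a ^ p / (p:ℂ) ^ m) q _ (fun N => ?_) P
  have h := abel_bound a ha (fun j => 1 / ((q + 2 + j : ℕ):ℝ) ^ m)
    (by
      intro i j hij
      dsimp only
      gcongr) (fun n => by positivity) N
  have e : ∑ j ∈ Finset.range N, a ^ (q+2+j) / ((q+2+j:ℕ):ℂ) ^ m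
      = a ^ (q+2) * ∑ j ∈ Finset.range N, a ^ j * ((1 / ((q + 2 + j : ℕ):ℝ) ^ m : ℝ) : ℂ) := by
    rw [Finset.mul_sum]
    refine Finset.sum_congr rfl fun j _ => ?_
    rw [pow_add]
    push_cast
    ring
  rw [e, norm_mul, norm_pow, ha, one_pow, one_mul]
  rw [norm_mul] at h
  have h2 : 1 / ((q + 2 + 0 : ℕ):ℝ) ^ m ≤ 1 / ((q:ℝ)+1) := by
    gcongr
    push_cast
    refine le_trans ?_ (le_self_pow₀ (by linarith [q.cast_nonneg (α := ℝ)]) (by omega))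
    linarith
  rw [div_div, div_eq_mul_inv, mul_inv, ← mul_assoc, mul_right_comm, ← div_eq_mul_inv _ ‖1 - a‖,
    le_div_iff₀' h1]
  refine h.trans ?_
  rw [one_div ((q:ℝ)+1)] at h2
  linarith

lemma tannery (b : ℂ) (hb : ‖b‖ = 1) (r : ℕ) (hr : 1 ≤ r) (f : ℕ → ℕ → ℂ) (L : ℕ → ℂ) (C : ℝ)
    (hC : 0 ≤ C)
    (hL : ∀ q, Tendsto (fun P => ∑ p ∈ Finset.Icc (q+2) P, f q p) atTop (𝓝 (L q)))
    (hB : ∀ q P, ‖∑ p ∈ Finset.Icc (q+2) P, f q p‖ ≤ C / ((q:ℝ)+1)) :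
    Tendsto (fun P : ℕ => ∑ q ∈ Finset.range P,
        b ^ (q+1) / ((q:ℂ)+1) ^ r * ∑ p ∈ Finset.Icc (q+2) P, f q p) atTop
      (𝓝 (∑' q : ℕ, b ^ (q+1) / ((q:ℂ)+1) ^ r * L q)) := by
  have h := tendsto_tsum_of_dominated_convergence (𝓕 := atTop)
    (f := fun (P q : ℕ) => b ^ (q+1) / ((q:ℂ)+1) ^ r * ∑ p ∈ Finset.Icc (q+2) P, f q p)
    (g := fun q : ℕ => b ^ (q+1) / ((q:ℂ)+1) ^ r * L q)
    (summable_sq.mul_left C) (fun q => (hL q).const_mul _)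
    (Eventually.of_forall fun P q => by
      have h2 : ‖b ^ (q+1) / ((q:ℂ)+1) ^ r‖ ≤ 1 / ((q:ℝ)+1) := by
        rw [norm_div, norm_pow, norm_pow, norm_succ, hb, one_pow]
        gcongr
        exact le_self_pow₀ (by linarith [q.cast_nonneg (α := ℝ)]) (by omega)
      rw [norm_mul]
      calc _ ≤ 1 / ((q:ℝ)+1) * (C / ((q:ℝ)+1)) :=
            mul_le_mul h2 (hB q P) (norm_nonneg _) (by positivity)
        _ = _ := by field_simp)
  refine h.congr fun P => ?_
  refine tsum_eq_sum fun q hq => ?_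
  rw [Finset.Icc_eq_empty (by simp at hq; omega)]
  simp

lemma Li2_tendsto (a b : ℂ) (ha : ‖a‖ = 1) (ha1 : a ≠ 1) (hb : ‖b‖ = 1)
    (r m : ℕ) (hr : 1 ≤ r) (hm : 1 ≤ m) :
    Tendsto (fun P : ℕ => ∑ q ∈ Finset.range P,
        b ^ (q+1) / ((q:ℂ)+1) ^ r * ∑ p ∈ Finset.Icc (q+2) P, a ^ p / (p:ℂ) ^ m) atTop
      (𝓝 (Li2 r m b a)) := by
  have h := tannery b hb r hr (fun _ p => a ^ p / (p:ℂ) ^ m) _ (2 / ‖1 - a‖) (by positivity)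
    (fun q => tendsto_nhds_limUnder (T_tendsto a ha ha1 m hm q)) (fun q P => T_bound a ha ha1 m hm q P)
  simpa [Li2] using h

lemma S_facts (a : ℂ) (ha : ‖a‖ = 1) (ha1 : a ≠ 1) (x : ℂ) (hx : 0 < x.re) :
    ∃ C : ℝ, 0 ≤ C ∧ ∀ q : ℕ,
      Tendsto (fun P => ∑ p ∈ Finset.Icc (q+2) P, a ^ p / (x * p + (q+1))) atTop
        (𝓝 (x⁻¹ * a ^ (q+2) * EE ((q+1) / x + (q+2)) a)) ∧
      ∀ P, ‖∑ p ∈ Finset.Icc (q+2) P, a ^ p / (x * p + (q+1))‖ ≤ C / ((q:ℝ)+1) := by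
  obtain ⟨C, hC, hE⟩ := EE_facts a ha ha1
  have hx0 : x ≠ 0 := by rintro rfl; simp at hx
  have hxi : 0 < (x⁻¹).re := by
    rw [Complex.inv_re]; exact div_pos hx (Complex.normSq_pos.2 hx0)
  refine ⟨‖x⁻¹‖ * (2 * C), by positivity, fun q => ?_⟩
  set w : ℂ := (q+1) / x + (q+2) with hw
  have hwre : (q:ℝ) + 1 ≤ w.re := by
    have : w.re = (q+1) * (x⁻¹).re + (q+2) := by
      rw [hw, div_eq_mul_inv]; simp
    rw [this]
    nlinarith [mul_nonneg (show (0:ℝ) ≤ q + 1 by positivity) hxi.le]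
  have hw0 : 0 < w.re := lt_of_lt_of_le (by positivity) hwre
  have e : ∀ N : ℕ, ∑ j ∈ Finset.range N, a ^ (q+2+j) / (x * (q+2+j:ℕ) + (q+1))
      = x⁻¹ * a ^ (q+2) * (EE w a - a ^ N * EE (w + N) a) := by
    intro N
    rw [← EE_sum a ha ha1 w hw0, Finset.mul_sum]
    refine Finset.sum_congr rfl fun j _ => ?_
    have : x * ((q+2+j:ℕ):ℂ) + (q+1) = x * (w + j) := by
      rw [hw]; push_cast; field_simp; ring
    rw [this, pow_add, ← div_div]
    ring
  have hEN : ∀ N : ℕ, ‖a ^ N * EE (w + N) a‖ ≤ C / ((N:ℝ) + 1) := by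
    intro N
    have h3 : (w + N).re = w.re + N := by simp
    rw [norm_mul, norm_pow, ha, one_pow, one_mul]
    refine (hE (w + N) (by rw [h3]; positivity)).2.2.trans ?_
    rw [h3]
    exact div_le_div_of_nonneg_left hC.le (by positivity) (by linarith [q.cast_nonneg (α := ℝ)])
  have hEN' : ∀ N : ℕ, ‖a ^ N * EE (w + N) a‖ ≤ C / ((q:ℝ) + 1) := by
    intro N
    have h3 : (w + N).re = w.re + N := by simp
    rw [norm_mul, norm_pow, ha, one_pow, one_mul]
    refine (hE (w + N) (by rw [h3]; positivity)).2.2.trans ?_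
    rw [h3]
    exact div_le_div_of_nonneg_left hC.le (by positivity) (by linarith [N.cast_nonneg (α := ℝ)])
  constructor
  · refine tendsto_Icc (fun p => a ^ p / (x * p + (q+1))) q _ ?_
    simp only [e]
    have h0 : Tendsto (fun N : ℕ => a ^ N * EE (w + N) a) atTop (𝓝 0) := by
      refine squeeze_zero_norm hEN ?_
      exact tendsto_const_div_atTop_nhds_zero_nat C |>.comp (tendsto_add_atTop_nat 1) |>.congr
        (fun n => by simp)
    simpa using (tendsto_const_nhds.sub h0).const_mul (x⁻¹ * a ^ (q+2))
  · refine bound_Icc (fun p => a ^ p / (x * p + (q+1))) q _ fun N => ?_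
    rw [e, norm_mul, norm_mul, norm_pow, ha, one_pow, mul_one, mul_div_assoc]
    gcongr
    have h0 := hEN' 0
    simp at h0
    refine (norm_sub_le _ _).trans ?_
    have := hEN' N
    rw [mul_div_assoc]
    linarith

lemma swap_sum (g : ℕ → ℕ → ℂ) (P : ℕ) :
    ∑ n ∈ Finset.range P, ∑ q ∈ Finset.range n, g q (n+1)
      = ∑ q ∈ Finset.range P, ∑ p ∈ Finset.Icc (q+2) P, g q p := by
  induction P with
  | zero => simp
  | succ P ih =>
    rw [Finset.sum_range_succ, ih, Finset.sum_range_succ _ P,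
      Finset.Icc_eq_empty (show ¬ (P + 2 ≤ P + 1) by omega), Finset.sum_empty, add_zero,
      ← Finset.sum_add_distrib]
    refine Finset.sum_congr rfl fun q hq => ?_
    rw [Finset.sum_Icc_succ_top (by simp at hq; omega)]

lemma pointwise (x u v : ℂ) (hu : u ≠ 0) (hv : v ≠ 0) (h : x * u + v ≠ 0) (n : ℕ) :
    1 / (u ^ n * (x * u + v)) = (-x) ^ n * (1 / v ^ n * (1 / (x * u + v)))
      + ∑ r ∈ Finset.Icc 1 n, (-x) ^ (r-1) * (1 / v ^ r * (1 / u ^ (n + 1 - r))) := by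
  induction n with
  | zero => simp
  | succ n ih =>
    have e : ∑ r ∈ Finset.Icc 1 n, (-x) ^ (r-1) * (1 / v ^ r * (1 / u ^ (n + 1 + 1 - r)))
        = u⁻¹ * ∑ r ∈ Finset.Icc 1 n, (-x) ^ (r-1) * (1 / v ^ r * (1 / u ^ (n + 1 - r))) := by
      rw [Finset.mul_sum]
      refine Finset.sum_congr rfl fun r hr => ?_
      have : n + 1 + 1 - r = (n + 1 - r) + 1 := by simp at hr; omega
      rw [this, pow_succ]
      field_simp
    have l : 1 / (u ^ (n+1) * (x * u + v)) = u⁻¹ * (1 / (u ^ n * (x * u + v))) := by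
      rw [pow_succ]; field_simp
    rw [Finset.sum_Icc_succ_top (by omega), e, l, ih]
    have : n + 1 + 1 - (n + 1) = 1 := by omega
    rw [this, Nat.add_sub_cancel]
    have key : u⁻¹ * ((-x) ^ n * (1 / v ^ n * (1 / (x * u + v))))
        = (-x) ^ (n+1) * (1 / v ^ (n+1) * (1 / (x * u + v)))
          + (-x) ^ n * (1 / v ^ (n+1) * (1 / u ^ 1)) := by
      rw [pow_succ, pow_succ]
      generalize hd : x * u + v = d at h
      generalize (-x) ^ n = X
      field_simp
      rw [← hd]
      ring
    linear_combination key

lemma hasSum_congr_aux {f g : ℕ → ℂ} {c : ℂ} (hg : HasSum g c) (h : ∀ i, f i = g i) :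
    HasSum f c := by
  have : f = g := funext h
  rw [this]; exact hg

lemma half (k : ℕ) (hk : 2 ≤ k) (α β : ℝ)
    (hα : e2pi α ≠ 1) (hβ : e2pi β ≠ 1) (x : ℂ) (hx : 0 < x.re) :
    HHZN k x α β - HHZN k (x + 1) (α + β) β + (-x) ^ (k - 2) * HHZN k ((x + 1) / x) (α + β) α
      = x⁻¹ * Li k (e2pi α) - (-x) ^ (k - 1) / (x + 1) * Li k (e2pi (α + β)) +
        ∑ r ∈ Finset.Icc 1 (k - 1), (-x) ^ (r - 1) * Li2 r (k - r) (e2pi β) (e2pi α) := by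
  obtain ⟨n, rfl⟩ := Nat.exists_eq_add_of_le' hk
  have hx0 : x ≠ 0 := by rintro rfl; simp at hx
  have hxi : 0 < (x⁻¹).re := by
    rw [Complex.inv_re]; exact div_pos hx (Complex.normSq_pos.2 hx0)
  have hx1 : 0 < (x + 1).re := by simp; linarith
  have hx10 : x + 1 ≠ 0 := by intro h; rw [h] at hx1; simp at hx1
  have hx2 : 0 < ((x + 1) / x).re := by
    have : (x + 1) / x = 1 + x⁻¹ := by field_simp
    rw [this]; simp; simp at hxi; linarith
  have H1 := HHZN_hasSum (n+2) hk x hx α β hβ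
  have H2 := HHZN_hasSum (n+2) hk (x+1) hx1 (α+β) β hβ
  have H3 := HHZN_hasSum (n+2) hk ((x+1)/x) hx2 (α+β) α hα
  have La := Li_hasSum_one (n+2) hk _ (e2pi_norm α)
  have Lab := Li_hasSum_one (n+2) hk _ (e2pi_norm (α+β))
  rw [e2pi_add] at H2 H3 Lab ⊢
  have ha := e2pi_norm α
  have hb := e2pi_norm β
  set a := e2pi α
  set b := e2pi β
  rw [show n + 2 - 1 = n + 1 from rfl] at *
  rw [show n + 2 - 2 = n from rfl] at *
  set F1 := HHZN (n+2) x α β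
  set F2 := HHZN (n+2) (x+1) (α+β) β
  set F3 := HHZN (n+2) ((x+1)/x) (α+β) α
  have hne : ∀ i : ℕ, (i:ℂ) + 1 ≠ 0 := fun i => Nat.cast_add_one_ne_zero i
  -- first part
  have D1 : HasSum (fun i : ℕ => ∑ j ∈ Finset.range i,
      a ^ (i+1) / ((i:ℂ)+1) ^ (n+1) * (b ^ (j+1) / (x * (i+1:ℕ) + (j+1))))
      (F1 - F2 - x⁻¹ * Li (n+2) a) := by
    refine hasSum_congr_aux ((H1.sub H2).sub (La.mul_left x⁻¹)) fun i => ?_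
    have hs := EE_sum b hb hβ (x * (i+1)) (by simp; positivity) (i+1)
    have hs2 : (x + 1) * ((i:ℂ)+1) = x * (i+1) + ((i+1:ℕ):ℂ) := by push_cast; ring
    rw [Finset.sum_range_succ'] at hs
    rw [hs2, mul_pow, ← Finset.mul_sum]
    have hs3 : ∑ j ∈ Finset.range i, b ^ (j+1) / (x * (i+1:ℕ) + (j+1))
      = EE (x * (i+1)) b - b ^ (i+1) * EE (x * (i+1) + ((i+1:ℕ):ℂ)) b - 1 / (x * (i+1)) := by
      rw [← hs]; simp
    rw [hs3]
    have := hne i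
    field_simp
    ring
  -- third part
  have D3 : HasSum (fun q : ℕ => b ^ (q+1) / ((q:ℂ)+1) ^ (n+1) *
      (x⁻¹ * a ^ (q+2) * EE ((q+1) / x + (q+2)) a))
      (x⁻¹ * (F3 - x / (x+1) * Li (n+2) (a * b))) := by
    refine hasSum_congr_aux ((H3.sub (Lab.mul_left (x/(x+1)))).mul_left x⁻¹) fun q => ?_
    have hre : 0 < ((x + 1) / x * ((q:ℂ)+1)).re := by
      have : ((x + 1) / x * ((q:ℂ)+1)).re = ((x + 1) / x).re * (q+1) := by simp
      rw [this]; positivity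
    rw [EE_succ a ha hα _ hre]
    have hz2 : (x + 1) / x * ((q:ℂ)+1) + 1 = (q+1) / x + (q+2) := by field_simp; ring
    rw [hz2]
    have := hne q
    rw [mul_pow]
    field_simp
    ring
  obtain ⟨C, hC, hS⟩ := S_facts a ha hα x hx
  have T1 := tannery b hb (n+1) (by omega) (fun q p => a ^ p / (x * p + (q+1))) _ C hC
    (fun q => (hS q).1) (fun q P => (hS q).2 P)
  rw [D3.tsum_eq] at T1
  have T2 : Tendsto (fun P => ∑ r ∈ Finset.Icc 1 (n+1), (-x) ^ (r-1) * ∑ q ∈ Finset.range P,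
        b ^ (q+1) / ((q:ℂ)+1) ^ r * ∑ p ∈ Finset.Icc (q+2) P, a ^ p / (p:ℂ) ^ (n + 2 - r)) atTop
      (𝓝 (∑ r ∈ Finset.Icc 1 (n+1), (-x) ^ (r-1) * Li2 r (n + 2 - r) b a)) :=
    tendsto_finsetSum _ fun r hr => (Li2_tendsto a b ha hα hb r (n+2-r)
      (by simp at hr; omega) (by simp at hr; omega)).const_mul _
  have T3 := D1.tendsto_sum_nat
  have T4 := (T1.const_mul ((-x)^(n+1))).add T2
  have hU := tendsto_nhds_unique T3 (T4.congr fun P => ?_)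
  · rw [← sub_eq_iff_eq_add'] at hU
    rw [← hU]
    rw [pow_succ]
    field_simp
    ring
  · have := swap_sum (fun q p => a ^ p / (p:ℂ) ^ (n+1) * (b ^ (q+1) / (x * p + (q+1)))) P
    simp only [Nat.cast_add, Nat.cast_one] at this ⊢
    rw [this, Finset.mul_sum]
    simp only [Finset.mul_sum]
    rw [Finset.sum_comm, ← Finset.sum_add_distrib]
    refine Finset.sum_congr rfl fun q _ => ?_
    rw [Finset.sum_comm, ← Finset.sum_add_distrib]
    refine Finset.sum_congr rfl fun p hp => ?_
    have hp0 : (0:ℝ) < p := by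
      have : 0 < p := by simp at hp; omega
      exact_mod_cast this
    have hpw := pointwise x p (q+1) (by exact_mod_cast hp0.ne') (hne q) (by
      intro h
      have := congrArg Complex.re h
      simp at this
      have := mul_pos hx hp0
      have := q.cast_nonneg (α := ℝ)
      linarith) (n+1)
    have e1 : a ^ p / (p:ℂ) ^ (n+1) * (b ^ (q+1) / (x * p + (q+1)))
      = a ^ p * b ^ (q+1) * (1 / ((p:ℂ) ^ (n+1) * (x * p + (q+1)))) := by
      simp only [div_eq_mul_inv, mul_inv]; ring
    rw [e1, hpw, mul_add, Finset.mul_sum]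
    congr 1
    · ring
    · refine Finset.sum_congr rfl fun r _ => ?_
      ring

/-- The six-term functional equation for the higher Herglotz–Zagier–Novikov function. -/
theorem HHZN_six_term_functional_equation (k : ℕ) (hk : 2 ≤ k) (α β : ℝ)
    (hα : ∀ n : ℤ, α ≠ n) (hβ : ∀ n : ℤ, β ≠ n) (x : ℂ) (hx : 0 < x.re) :
    HHZN k x α β + HHZN k x (-α) (-β)
      - HHZN k (x + 1) (α + β) β - HHZN k (x + 1) (-α - β) (-β)
      + (-x) ^ (k - 2) * HHZN k ((x + 1) / x) (α + β) α
      + (-x) ^ (k - 2) * HHZN k ((x + 1) / x) (-α - β) (-α)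
      = x⁻¹ * (Li k (e2pi α) + Li k (e2pi (-α)))
        - (-x) ^ (k - 1) / (x + 1) * (Li k (e2pi (α + β)) + Li k (e2pi (-(α + β)))) +
        ∑ r ∈ Finset.Icc 1 (k - 1),
          (-x) ^ (r - 1) *
            (Li2 r (k - r) (e2pi β) (e2pi α) + Li2 r (k - r) (e2pi (-β)) (e2pi (-α))) := by
  have ha := e2pi_ne_one α hα
  have hb := e2pi_ne_one β hβ
  have ha' := e2pi_ne_one (-α) (fun n h => hα (-n) (by push_cast; linarith))
  have hb' := e2pi_ne_one (-β) (fun n h => hβ (-n) (by push_cast; linarith))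
  have h1 := half k hk α β ha hb x hx
  have h2 := half k hk (-α) (-β) ha' hb' x hx
  have e1 : -α + -β = -α - β := by ring
  have e2 : -(α + β) = -α - β := by ring
  rw [e1] at h2
  rw [e2]
  simp only [mul_add, Finset.sum_add_distrib]
  linear_combination h1 + h2

end
end

section
/- Let τ ∈ ℂ with Im(τ) > 0, let 0 < β < 1, α ∈ ℝ, and let s ∈ ℂ with Re(s) > 2. Then (Γ(s)/(−2πi)^s) · Σ_{m ∈ ℤ} Σ_{n ∈ ℤ} ((m+β)τ + n + α)^{−s} = A(τ, s, β, α) + e^{πis} · A(τ, s, −β, −α), where the double series on the left converges absolutely (no term has vanishing base, since m + β ≠ 0 for all m ∈ ℤ), (−2πi)^s and all powers w^{−s} are taken with the principal branch of the complex logarithm. -/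
open Complex MeasureTheory Filter Topology Set Asymptotics

noncomputable section

/-- Berndt's generalized Dedekind eta-function
`A(τ, s, β, α) = ∑_{m ∈ ℤ, m > -β} ∑_{n ≥ 1} n^{s-1} e^{2πin(α+βτ)} e^{2πimnτ}`. -/
def dedekindA (τ s : ℂ) (β α : ℝ) : ℂ :=
  ∑' m : {m : ℤ // -β < (m : ℝ)}, ∑' n : ℕ,
    ((n + 1 : ℕ) : ℂ) ^ (s - 1) *
      Complex.exp (2 * Real.pi * Complex.I * (n + 1) * ((α : ℂ) + (β : ℂ) * τ)) *
      Complex.exp (2 * Real.pi * Complex.I * ((m : ℤ) : ℂ) * (n + 1) * τ)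


lemma bd_gint (s : ℂ) (hs : 0 < s.re) {r : ℝ} (hr : 0 < r) :
    IntegrableOn (fun t : ℝ => t ^ (s.re - 1) * Real.exp (-(r * t))) (Ioi 0) := by
  have := integrableOn_rpow_mul_exp_neg_mul_rpow (p := 1) (s := s.re - 1) (b := r)
    (by linarith) one_pos hr
  simpa [neg_mul] using this

lemma bd_meas (s r : ℂ) : AEStronglyMeasurable
    (fun t : ℝ => (t : ℂ) ^ (s - 1) * exp (-(r * t))) (volume.restrict (Ioi 0)) := by
  refine ContinuousOn.aestronglyMeasurable (fun t ht => ?_) measurableSet_Ioi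
  refine ContinuousAt.continuousWithinAt ?_
  refine ContinuousAt.mul ?_ (by fun_prop)
  exact (continuousAt_ofReal_cpow_const _ _ (Or.inr (ne_of_gt ht)))

lemma bd_norm (s r : ℂ) {t : ℝ} (ht : 0 < t) :
    ‖(t : ℂ) ^ (s - 1) * exp (-(r * t))‖ = t ^ (s.re - 1) * Real.exp (-(r.re * t)) := by
  rw [norm_mul, norm_cpow_eq_rpow_re_of_pos ht, norm_exp]
  simp

lemma bd_integrable (s r : ℂ) (hs : 0 < s.re) (hr : 0 < r.re) :
    IntegrableOn (fun t : ℝ => (t : ℂ) ^ (s - 1) * exp (-(r * t))) (Ioi 0) := by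
  refine (integrable_norm_iff (bd_meas s r)).1 ?_
  refine (bd_gint s hs hr).congr_fun (fun t ht => ?_) measurableSet_Ioi
  exact (bd_norm s r ht).symm

lemma bd_diff (s r : ℂ) (hs : 0 < s.re) (hr : 0 < r.re) :
    DifferentiableAt ℂ (fun r : ℂ => ∫ t in Ioi (0 : ℝ), (t : ℂ) ^ (s - 1) * exp (-(r * t))) r := by
  have hU : {w : ℂ | r.re / 2 < w.re} ∈ 𝓝 r :=
    (isOpen_lt continuous_const continuous_re).mem_nhds (by simp; linarith)
  refine (hasDerivAt_integral_of_dominated_loc_of_deriv_le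
    (F' := fun r t => -((t : ℂ) ^ (s + 1 - 1) * exp (-(r * t))))
    (bound := fun t => t ^ ((s + 1).re - 1) * Real.exp (-(r.re / 2 * t))) hU
    (Eventually.of_forall fun x => bd_meas s x) (bd_integrable s r hs hr)
    (bd_meas (s + 1) r).neg ?_ (bd_gint (s + 1) (by simp; linarith) (by linarith)) ?_).2.differentiableAt
  · refine (ae_restrict_iff' measurableSet_Ioi).2 (Eventually.of_forall fun t ht x hx => ?_)
    have ht' : 0 < t := ht
    have hx' : r.re / 2 < x.re := hx
    rw [norm_neg, bd_norm _ _ ht]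
    gcongr
  · refine (ae_restrict_iff' measurableSet_Ioi).2 (Eventually.of_forall fun t ht x hx => ?_)
    have ht' : (t : ℂ) ≠ 0 := by exact_mod_cast (ne_of_gt ht)
    have h1 : HasDerivAt (fun r : ℂ => -(r * t)) (-(1 * (t : ℂ))) x :=
      ((hasDerivAt_id x).mul_const (t : ℂ)).neg
    have h2 := (h1.cexp).const_mul ((t : ℂ) ^ (s - 1))
    convert! h2 using 1
    have : (t : ℂ) ^ (s + 1 - 1) = (t : ℂ) ^ (s - 1) * t := by
      rw [show s + 1 - 1 = (s - 1) + 1 by ring, cpow_add _ _ ht', cpow_one]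
    rw [this]; ring

lemma bd_gamma (s r : ℂ) (hs : 0 < s.re) (hr : 0 < r.re) :
    ∫ t in Ioi (0 : ℝ), (t : ℂ) ^ (s - 1) * exp (-(r * t)) = r ^ (-s) * Gamma s := by
  have hUo : IsOpen {w : ℂ | 0 < w.re} := isOpen_lt continuous_const continuous_re
  have hUc : IsPreconnected {w : ℂ | 0 < w.re} := (convex_halfSpace_re_gt 0).isPreconnected
  have hf : AnalyticOnNhd ℂ
      (fun r : ℂ => ∫ t in Ioi (0 : ℝ), (t : ℂ) ^ (s - 1) * exp (-(r * t))) {w : ℂ | 0 < w.re} :=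
    DifferentiableOn.analyticOnNhd
      (fun w hw => (bd_diff s w hs hw).differentiableWithinAt) hUo
  have hg : AnalyticOnNhd ℂ (fun r : ℂ => r ^ (-s) * Gamma s) {w : ℂ | 0 < w.re} :=
    DifferentiableOn.analyticOnNhd
      (fun w hw => (((differentiableAt_id).cpow_const (Or.inl hw)).mul_const
        _).differentiableWithinAt) hUo
  refine hf.eqOn_of_preconnected_of_frequently_eq hg hUc (z₀ := 1) (by simp) ?_ hr
  have ht : Tendsto (fun n : ℕ => ((1 + 1 / ((n : ℝ) + 1) : ℝ) : ℂ)) atTop (𝓝[≠] 1) := by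
    refine tendsto_nhdsWithin_iff.2 ⟨?_, Eventually.of_forall fun n => ?_⟩
    · have := (tendsto_one_div_add_atTop_nhds_zero_nat (𝕜 := ℝ)).const_add 1
      rw [add_zero] at this
      simpa only [ofReal_one] using! (continuous_ofReal.tendsto 1).comp this
    · have : (0 : ℝ) < 1 / ((n : ℝ) + 1) := by positivity
      simp only [mem_compl_iff, mem_singleton_iff]
      intro h
      have h' : (1 + 1 / ((n : ℝ) + 1) : ℝ) = 1 := by exact_mod_cast h
      linarith
  refine ht.frequently (Frequently.of_forall fun n => ?_)
  have hp : (0 : ℝ) < 1 + 1 / ((n : ℝ) + 1) := by positivity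
  generalize 1 + 1 / ((n : ℝ) + 1) = q at hp
  rw [integral_cpow_mul_exp_neg_mul_Ioi hs hp, one_div, inv_cpow, cpow_neg]
  rw [arg_ofReal_of_nonneg hp.le]; exact Real.pi_pos.ne

/-- rotation -/
lemma bd_rot (z s : ℂ) (hz : 0 < z.im) :
    (-(2 * Real.pi * I * z)) ^ (-s) = z ^ (-s) / (-2 * Real.pi * I) ^ s := by
  have hz0 : z ≠ 0 := by rintro rfl; simp at hz
  have hI : (-2 * Real.pi * I : ℂ) = ((2 * Real.pi : ℝ) : ℂ) * (-I) := by push_cast; ring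
  have h2 : (-(2 * Real.pi * I * z) : ℂ) = ((2 * Real.pi : ℝ) : ℂ) * (-I * z) := by push_cast; ring
  have hp : 0 < 2 * Real.pi := by positivity
  have hargI : arg (-I) = -(Real.pi / 2) := arg_neg_I
  have hmem := arg_mem_Ioc z
  have h0 : 0 < arg z := by
    rcases (arg_nonneg_iff.2 hz.le).lt_or_eq with h | h
    · exact h
    · exact absurd (arg_eq_zero_iff.1 h.symm).2 hz.ne'
  have hlog : log (-I * z) = log (-I) + log z := by
    refine log_mul (by simp) hz0 ?_
    rw [hargI]
    constructor <;> [skip; skip] <;> have := Real.pi_pos <;> linarith [hmem.2]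
  have hIz : -I * z ≠ 0 := by simp [hz0]
  have hpc : ((2 * Real.pi : ℝ) : ℂ) ≠ 0 := by exact_mod_cast hp.ne'
  rw [hI, h2, cpow_def_of_ne_zero (mul_ne_zero hpc hIz), cpow_def_of_ne_zero hz0,
    cpow_def_of_ne_zero (mul_ne_zero hpc (by simp)), log_ofReal_mul hp hIz,
    log_ofReal_mul hp (by simp), hlog, ← exp_sub]
  congr 1; ring

lemma bd_neg (z s : ℂ) (hz : 0 < z.im) :
    (-z) ^ (-s) = exp (Real.pi * I * s) * z ^ (-s) := by
  have hz0 : z ≠ 0 := by rintro rfl; simp at hz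
  rw [cpow_def_of_ne_zero (neg_ne_zero.2 hz0), cpow_def_of_ne_zero hz0, ← exp_add]
  congr 1
  rw [log, log, arg_neg_eq_arg_sub_pi_of_im_pos hz, norm_neg]
  push_cast; ring

lemma bd_cpow_le (w s : ℂ) : ‖w ^ (-s)‖ ≤ Real.exp (Real.pi * |s.im|) * ‖w‖ ^ (-s.re) := by
  refine (norm_cpow_le _ _).trans ?_
  rw [div_eq_mul_inv, ← Real.exp_neg, mul_comm, neg_re, neg_im]
  gcongr
  have := mul_le_mul (abs_arg_le_pi w) le_rfl (abs_nonneg s.im) Real.pi_pos.le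
  rw [← abs_mul] at this
  linarith [le_abs_self (arg w * s.im)]

lemma bd_summable (τ : ℂ) (hτ : 0 < τ.im) (β α : ℝ) (s : ℂ) (hs : 2 < s.re) :
    Summable (fun mn : ℤ × ℤ =>
      ‖((((mn.1 : ℂ) + β) * τ + (mn.2 : ℂ) + α) : ℂ) ^ (-s)‖) := by
  rw [← (finTwoArrowEquiv ℤ).summable_iff]
  set c : ℂ := β * τ + α with hc
  let z : UpperHalfPlane := ⟨τ, hτ⟩
  have hr := EisensteinSeries.r_pos z
  set r := EisensteinSeries.r z
  have hsum := (EisensteinSeries.summable_one_div_norm_rpow hs).mul_left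
    (Real.exp (Real.pi * |s.im|) * (r / 2) ^ (-s.re))
  refine hsum.of_norm_bounded_eventually ?_
  have ht : Tendsto (fun x : Fin 2 → ℤ => ‖x‖) cofinite atTop := by
    rw [← cocompact_eq_cofinite]; exact tendsto_norm_cocompact_atTop
  filter_upwards [ht.eventually_ge_atTop (2 * ‖c‖ / r + 1)] with x hx
  have hx0 : 0 < ‖x‖ := lt_of_lt_of_le (by positivity) hx
  have h1 : r * ‖x‖ ≤ ‖x 0 * τ + x 1‖ := EisensteinSeries.r_mul_max_le z (norm_pos_iff.1 hx0)
  have h2 : ‖c‖ ≤ r / 2 * ‖x‖ := by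
    have : 2 * ‖c‖ / r ≤ ‖x‖ := by linarith
    rw [div_le_iff₀ hr] at this
    linarith
  have h3 : r / 2 * ‖x‖ ≤ ‖((x 0 : ℂ) + β) * τ + (x 1 : ℂ) + α‖ := by
    have : ((x 0 : ℂ) + β) * τ + (x 1 : ℂ) + α = (x 0 * τ + x 1) + c := by rw [hc]; ring
    rw [this]
    have := norm_sub_le_norm_add (x 0 * τ + x 1) c
    linarith
  simp only [Function.comp, norm_norm, finTwoArrowEquiv_apply]
  refine (bd_cpow_le _ _).trans ?_
  rw [mul_assoc, ← Real.mul_rpow (by positivity) (by positivity)]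
  gcongr ?_ * ?_
  exact Real.rpow_le_rpow_of_nonpos (by positivity) h3 (by linarith)

lemma bd_summable_one (z s : ℂ) (hz : 0 < z.im) (hs : 2 < s.re) :
    Summable (fun n : ℤ => (z + n) ^ (-s)) := by
  have h := (bd_summable z hz 1 0 s hs).of_norm
  have := h.comp_injective (i := fun n : ℤ => ((0 : ℤ), n)) (fun a b hab => by simpa using hab)
  simpa [Function.comp_def] using this

def bd_f (z s : ℂ) (t : ℝ) : ℂ :=
  ((max t 0 : ℝ) : ℂ) ^ (s - 1) * exp (2 * Real.pi * I * z * t)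

open FourierTransform in
lemma bd_fourier (z s : ℂ) (hz : 0 < z.im) (hs : 2 < s.re) (x : ℝ) :
    𝓕 (bd_f z s) x = Gamma s / (-2 * Real.pi * I) ^ s * (z - x) ^ (-s) := by
  have hs1 : s - 1 ≠ 0 := by
    intro h
    have := congrArg re h
    simp at this; linarith
  have him : 0 < (z - x).im := by simpa using hz
  have h := bd_gamma s (-(2 * Real.pi * I * (z - x))) (by linarith)
    (by simp; exact mul_pos (by positivity) hz)
  rw [← integral_indicator measurableSet_Ioi, bd_rot _ _ him] at h
  rw [Real.fourier_real_eq_integral_exp_smul, 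
    show Gamma s / (-2 * Real.pi * I) ^ s * (z - x) ^ (-s) =
      (z - x) ^ (-s) / (-2 * Real.pi * I) ^ s * Gamma s by ring, ← h]
  congr 1; ext t
  rcases lt_or_ge 0 t with ht | ht
  · rw [indicator_of_mem (show t ∈ Ioi 0 from ht), bd_f, max_eq_left ht.le, smul_eq_mul,
      mul_left_comm, ← exp_add]
    congr 2; push_cast; ring
  · rw [indicator_of_notMem (by simpa using ht), bd_f, max_eq_right ht, ofReal_zero,
      zero_cpow hs1]
    simp

lemma bd_f_cont (z s : ℂ) (hs : 2 < s.re) : Continuous (bd_f z s) := by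
  unfold bd_f
  refine Continuous.mul ?_ (by fun_prop)
  exact (continuous_ofReal_cpow_const (y := s - 1) (by simp; linarith)).comp
    (continuous_id.max continuous_const)

lemma bd_f_decay (z s : ℂ) (hz : 0 < z.im) (hs : 2 < s.re) :
    bd_f z s =O[cocompact ℝ] (fun x : ℝ => |x| ^ (-2 : ℝ)) := by
  have hs1 : s - 1 ≠ 0 := by
    intro h
    have := congrArg re h
    simp at this; linarith
  rw [cocompact_eq_atBot_atTop, isBigO_sup]
  constructor
  · refine IsBigO.of_bound 0 ?_
    filter_upwards [eventually_le_atBot 0] with t ht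
    rw [bd_f, max_eq_right ht, ofReal_zero, zero_cpow hs1]
    simp
  · have h := (isLittleO_exp_neg_mul_rpow_atTop (a := 2 * Real.pi * z.im) (by positivity)
      (-2 - (s.re - 1))).isBigO
    have h2 := (isBigO_refl (fun t : ℝ => t ^ (s.re - 1)) atTop).mul h
    refine IsBigO.trans (IsBigO.of_norm_eventuallyLE ?_) (h2.trans (EventuallyEq.isBigO ?_))
    · filter_upwards [eventually_gt_atTop 0] with t ht
      rw [bd_f, max_eq_left ht.le, norm_mul, norm_cpow_eq_rpow_re_of_pos ht, norm_exp]
      simp [mul_assoc]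
    · filter_upwards [eventually_gt_atTop 0] with t ht
      rw [← Real.rpow_add ht, abs_of_pos ht]
      congr 1; ring

lemma bd_lipschitz (z s : ℂ) (hz : 0 < z.im) (hs : 2 < s.re) :
    Gamma s / (-2 * Real.pi * I) ^ s * ∑' n : ℤ, (z + n) ^ (-s) =
      ∑' n : ℕ, ((n + 1 : ℕ) : ℂ) ^ (s - 1) * exp (2 * Real.pi * I * (n + 1) * z) := by
  have hs1 : s - 1 ≠ 0 := by
    intro h
    have := congrArg re h
    simp at this; linarith
  have hsum : Summable (fun n : ℤ => (z - n) ^ (-s)) := by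
    have := (Equiv.neg ℤ).summable_iff.2 (bd_summable_one z s hz hs)
    refine this.congr fun n => ?_
    simp [sub_eq_add_neg]
  have hP := Real.tsum_eq_tsum_fourier_of_rpow_decay_of_summable (bd_f_cont z s hs)
    one_lt_two (bd_f_decay z s hz hs) (by
      refine (hsum.mul_left (Gamma s / (-2 * Real.pi * I) ^ s)).congr fun n => ?_
      rw [bd_fourier z s hz hs]; simp) 0
  have hR : ∑' n : ℤ, (z + n) ^ (-s) = ∑' n : ℤ, (z - n) ^ (-s) := by
    rw [← (Equiv.neg ℤ).tsum_eq]
    refine tsum_congr fun n => ?_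
    simp [sub_eq_add_neg]
  rw [hR, ← tsum_mul_left]
  have hinj : Function.Injective (fun n : ℕ => (n : ℤ) + 1) := fun a b h => by simpa using h
  have hL := hinj.tsum_eq (f := fun n : ℤ => bd_f z s (0 + n)) (by
    intro n hn
    rcases lt_or_ge 0 n with h | h
    · exact ⟨(n - 1).toNat, by simp; omega⟩
    · refine absurd ?_ hn
      have : (0 : ℝ) + n ≤ 0 := by simpa using h
      simp only
      rw [bd_f, max_eq_right this, ofReal_zero, zero_cpow hs1, zero_mul])
  rw [← hL] at hP
  refine Eq.trans ?_ (hP.symm.trans ?_)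
  · refine tsum_congr fun n => ?_
    rw [bd_fourier z s hz hs]
    simp
  · refine tsum_congr fun n => ?_
    have : (0 : ℝ) ≤ n + 1 := by positivity
    rw [bd_f]
    push_cast
    rw [zero_add, max_eq_left this]
    push_cast
    congr 2; ring

/-- Berndt's identity relating the generalized Eisenstein series and the generalized Dedekind
eta-function: for `Im τ > 0`, `0 < β < 1`, `α ∈ ℝ` and `Re s > 2`,
`(Γ(s)/(-2πi)^s) ∑_{m,n ∈ ℤ} ((m+β)τ+n+α)^{-s} = A(τ,s,β,α) + e^{πis} A(τ,s,-β,-α)`,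
the double series converging absolutely; all powers use the principal branch. -/
theorem berndt_eisenstein_eta_identity (τ : ℂ) (hτ : 0 < τ.im) (β α : ℝ)
    (hβ0 : 0 < β) (hβ1 : β < 1) (s : ℂ) (hs : 2 < s.re) :
    Summable (fun mn : ℤ × ℤ =>
      ‖((((mn.1 : ℂ) + β) * τ + (mn.2 : ℂ) + α) : ℂ) ^ (-s)‖) ∧
    Complex.Gamma s / (-2 * Real.pi * Complex.I) ^ s *
        ∑' mn : ℤ × ℤ, ((((mn.1 : ℂ) + β) * τ + (mn.2 : ℂ) + α) : ℂ) ^ (-s)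
      = dedekindA τ s β α +
        Complex.exp (Real.pi * Complex.I * s) * dedekindA τ s (-β) (-α) := by
  have hS := bd_summable τ hτ β α s hs
  refine ⟨hS, ?_⟩
  have hS' := hS.of_norm
  set C : ℂ := Complex.Gamma s / (-2 * Real.pi * Complex.I) ^ s with hC
  rw [hS'.tsum_prod, ← tsum_mul_left]
  have hg : Summable (fun m : ℤ => C * ∑' n : ℤ, (((m : ℂ) + β) * τ + (n : ℂ) + α) ^ (-s)) :=
    hS'.prod.mul_left C
  rw [← hg.tsum_subtype_add_tsum_subtype_compl {m : ℤ | -β < (m : ℝ)}]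
  congr 1
  · unfold dedekindA
    refine tsum_congr fun m => ?_
    have hm : -β < ((m : ℤ) : ℝ) := m.2
    have him : 0 < ((((m : ℤ) : ℂ) + β) * τ + α).im := by
      simp; exact mul_pos (by linarith) hτ
    refine Eq.trans ?_ ((bd_lipschitz _ s him hs).trans ?_)
    · congr 1
      refine tsum_congr fun n => ?_
      congr 1; ring
    · refine tsum_congr fun n => ?_
      rw [mul_assoc (_ ^ _) (Complex.exp _), ← Complex.exp_add]
      congr 2; ring
  · let e : {m : ℤ // -(-β) < (m : ℝ)} ≃ ({m : ℤ | -β < (m : ℝ)}ᶜ : Set ℤ) :=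
      { toFun := fun m => ⟨-m.1, by
          have := m.2
          simp only [mem_compl_iff, mem_setOf_eq, not_lt]; push_cast; linarith⟩
        invFun := fun m => ⟨-m.1, by
          have h : ((m : ℤ) : ℝ) ≤ -β := not_lt.1 m.2
          have h0 : ((m : ℤ) : ℝ) < 0 := by linarith
          have h1 : (m : ℤ) < 0 := by exact_mod_cast h0
          have h2 : (m : ℤ) ≤ -1 := by omega
          have h3 : ((m : ℤ) : ℝ) ≤ -1 := by exact_mod_cast h2
          push_cast; linarith⟩
        left_inv := fun m => by simp
        right_inv := fun m => by simp }
    rw [← e.tsum_eq]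
    unfold dedekindA
    rw [← tsum_mul_left]
    refine tsum_congr fun m => ?_
    have hm : -(-β) < ((m : ℤ) : ℝ) := m.2
    have him : 0 < ((((m : ℤ) : ℂ) - β) * τ - α).im := by
      simp; exact mul_pos (by linarith) hτ
    have hL := bd_lipschitz _ s him hs
    have key : ∑' n : ℤ, ((((e m : ℤ) : ℂ) + β) * τ + (n : ℂ) + α) ^ (-s) =
        Complex.exp (Real.pi * Complex.I * s) *
          ∑' n : ℤ, ((((m : ℤ) : ℂ) - β) * τ - α + n) ^ (-s) := by
      rw [← (Equiv.neg ℤ).tsum_eq, ← tsum_mul_left]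
      refine tsum_congr fun n => ?_
      rw [← bd_neg _ _ (by simpa using him)]
      congr 1
      simp only [e, Equiv.coe_fn_mk, Equiv.neg_apply]
      push_cast; ring
    rw [key, mul_left_comm, hC, hL]
    congr 1
    refine tsum_congr fun n => ?_
    rw [mul_assoc (_ ^ _) (Complex.exp _), ← Complex.exp_add]
    congr 2; push_cast; ring

end
end
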